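/- arXiv:1805.10974 — 9 statements merged into one kernel-verified Lean document; each statement's English description precedes it below -/
import Mathlib

section
/- Let p, q be positive integers and z ∈ ℂ with sin(z^q) ≠ 0 and cos(z^q) ≠ 0, and set λ = z / tan(z^q)^p (so that z is a fixed point of f_λ). Then the multiplier of f_λ at z is deriv f_λ z = 2·p·q·z^q / sin(2·z^q). -/
open Complex

/-- If `z` is a fixed point of `f_λ(w) = λ·tan(w^q)^p` (i.e. `λ = z / tan(z^q)^p`),
then the multiplier there is `2pq z^q / sin (2 z^q)`. -/
theorem multiplier_fixed_point (p q : ℕ) (hp : 0 < p) (hq : 0 < q) (z : ℂ)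
    (hsin : Complex.sin (z ^ q) ≠ 0) (hcos : Complex.cos (z ^ q) ≠ 0)
    (lam : ℂ) (hlam : lam = z / Complex.tan (z ^ q) ^ p) :
    deriv (fun w : ℂ => lam * Complex.tan (w ^ q) ^ p) z
      = 2 * (p : ℂ) * (q : ℂ) * z ^ q / Complex.sin (2 * z ^ q) := by
  obtain ⟨m, rfl⟩ := Nat.exists_eq_add_of_lt hp
  obtain ⟨n, rfl⟩ := Nat.exists_eq_add_of_lt hq
  simp only [zero_add] at *
  have h : HasDerivAt (fun w : ℂ => lam * Complex.tan (w ^ (n + 1)) ^ (m + 1)) _ z :=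
    (((Complex.hasDerivAt_tan hcos).comp z (hasDerivAt_pow (n + 1) z)).pow (m + 1)).const_mul lam
  rw [h.deriv, hlam, Complex.sin_two_mul]
  simp only [Function.comp_apply, Nat.add_sub_cancel, Complex.tan_eq_sin_div_cos]
  generalize hs : Complex.sin (z ^ (n + 1)) = s at *
  generalize hc : Complex.cos (z ^ (n + 1)) = c at *
  rw [pow_succ z n]
  field_simp
  rw [pow_succ (s / c) m]
  field_simp
end

section
/- Let p, q be positive integers, λ ∈ ℂ, n a positive integer, and let z : ZMod n → ℂ (or z₀, …, z_{n−1} ∈ ℂ) satisfy f_λ(zᵢ) = z_{i+1 mod n} for all i, with sin(zᵢ^q) ≠ 0 and cos(zᵢ^q) ≠ 0 for all i. Then the multiplier of the cycle satisfies ∏_{i=0}^{n−1} deriv f_λ (zᵢ) = (2·p·q)^n · ∏_{i=0}^{n−1} zᵢ^q / sin(2·zᵢ^q). -/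
open Complex Finset

/-- The logarithmic derivative of `w ↦ c * tan (w ^ q) ^ p`, cleared of denominators. -/
theorem deriv_mul_tan_pow_mul_self {p q : ℕ} (hp : p ≠ 0) (hq : q ≠ 0) (c : ℂ) {w : ℂ}
    (hsin : Complex.sin (w ^ q) ≠ 0) (hcos : Complex.cos (w ^ q) ≠ 0) :
    deriv (fun w : ℂ => c * Complex.tan (w ^ q) ^ p) w * w
      = c * Complex.tan (w ^ q) ^ p
        * (2 * (p : ℂ) * (q : ℂ) * (w ^ q / Complex.sin (2 * w ^ q))) := by
  have ht : HasDerivAt (fun w : ℂ => Complex.tan (w ^ q))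
      (1 / Complex.cos (w ^ q) ^ 2 * (q * w ^ (q - 1))) w :=
    (Complex.hasDerivAt_tan hcos).comp w (hasDerivAt_pow q w)
  have hd := (ht.fun_pow p).const_mul c
  rw [hd.deriv, Complex.sin_two_mul]
  obtain ⟨p, rfl⟩ := Nat.exists_eq_succ_of_ne_zero hp
  obtain ⟨q, rfl⟩ := Nat.exists_eq_succ_of_ne_zero hq
  simp only [Nat.succ_eq_add_one, Nat.add_sub_cancel]
  rw [pow_succ (Complex.tan _) p]
  nth_rw 3 [Complex.tan_eq_sin_div_cos]
  field_simp
  ring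

/-- Shifting the index cyclically does not change a product over `range n`. -/
theorem prod_range_add_one_mod {M : Type*} [CommMonoid M] (n : ℕ) (z : ℕ → M) :
    ∏ i ∈ Finset.range n, z ((i + 1) % n) = ∏ i ∈ Finset.range n, z i := by
  cases n with
  | zero => simp
  | succ m =>
    rw [Finset.prod_range_succ, Finset.prod_range_succ', Nat.mod_self]
    congr 1
    refine Finset.prod_congr rfl fun i hi => ?_
    rw [Nat.mod_eq_of_lt (Nat.succ_lt_succ (Finset.mem_range.mp hi))]

/-- The multiplier of a period-`n` cycle `z₀, …, z_{n-1}` of `f_λ(w) = λ·tan(w^q)^p`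
is `(2pq)^n ∏ zᵢ^q / sin (2 zᵢ^q)`. -/
theorem multiplier_cycle (p q : ℕ) (hp : 0 < p) (hq : 0 < q) (lam : ℂ)
    (n : ℕ) (hn : 0 < n) (z : ℕ → ℂ)
    (hcycle : ∀ i < n, (fun w : ℂ => lam * Complex.tan (w ^ q) ^ p) (z i) = z ((i + 1) % n))
    (hsin : ∀ i < n, Complex.sin ((z i) ^ q) ≠ 0)
    (hcos : ∀ i < n, Complex.cos ((z i) ^ q) ≠ 0) :
    ∏ i ∈ Finset.range n, deriv (fun w : ℂ => lam * Complex.tan (w ^ q) ^ p) (z i)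
      = (2 * (p : ℂ) * (q : ℂ)) ^ n
        * ∏ i ∈ Finset.range n, (z i) ^ q / Complex.sin (2 * (z i) ^ q) := by
  have hz : ∏ i ∈ Finset.range n, z i ≠ 0 := by
    refine Finset.prod_ne_zero_iff.mpr fun i hi h0 => hsin i (Finset.mem_range.mp hi) ?_
    rw [h0, zero_pow hq.ne', Complex.sin_zero]
  refine mul_right_cancel₀ hz ?_
  calc _ = ∏ i ∈ Finset.range n, (z ((i + 1) % n)
          * (2 * (p : ℂ) * (q : ℂ) * ((z i) ^ q / Complex.sin (2 * (z i) ^ q)))) := by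
        rw [← Finset.prod_mul_distrib]
        refine Finset.prod_congr rfl fun i hi => ?_
        have hi := Finset.mem_range.mp hi
        rw [deriv_mul_tan_pow_mul_self hp.ne' hq.ne' lam (hsin i hi) (hcos i hi), ← hcycle i hi]
    _ = _ := by
        rw [Finset.prod_mul_distrib, prod_range_add_one_mod, Finset.prod_mul_distrib,
          Finset.prod_const, Finset.card_range, mul_comm]
end

section
/- Let p, q be positive integers with p·q odd, λ ∈ ℂ, and let n be an odd positive integer. Suppose z ∈ ℂ, z ≠ 0, satisfies f_λ^[n](z) = z and f_λ^[n] is complex differentiable at z. Then f_{−λ}^[n](z) = −z ≠ z, f_{−λ}^[2n](z) = z, and the multiplier of this period-2n point of f_{−λ} is the square of the original multiplier: deriv (f_{−λ}^[2n]) z = (deriv (f_λ^[n]) z)². -/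
open Complex Function

/-- For an odd map `f`, the odd iterates of `-f` are the negatives of those of `f`. -/
theorem iterate_neg_of_odd {α : Type*} [InvolutiveNeg α] {f : α → α} (hf : f.Odd) {n : ℕ}
    (hn : Odd n) : (fun w => -f w)^[n] = fun w => -f^[n] w := by
  have hcomm : Function.Commute (Neg.neg : α → α) f := fun w => (hf w).symm
  have h := hcomm.comp_iterate n
  rwa [neg_involutive.iterate_odd hn] at h

/-- For an odd map `f`, the even iterates of `-f` are those of `f`. -/
theorem iterate_neg_of_even {α : Type*} [InvolutiveNeg α] {f : α → α} (hf : f.Odd) {n : ℕ}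
    (hn : Even n) : (fun w => -f w)^[n] = f^[n] := by
  have hcomm : Function.Commute (Neg.neg : α → α) f := fun w => (hf w).symm
  have h := hcomm.comp_iterate n
  rwa [neg_involutive.iterate_even hn] at h

theorem odd_mul_tan_pow_pow {p q : ℕ} (hp : Odd p) (hq : Odd q) (c : ℂ) :
    (fun w : ℂ => c * Complex.tan (w ^ q) ^ p).Odd := fun w => by
  simp only [hq.neg_pow, Complex.tan_neg, hp.neg_pow, mul_neg]

/-- For `pq` odd and `n` odd, a fixed point `z ≠ 0` of `f_λ^[n]` gives a period-`2n`
point of `f_{-λ}` whose multiplier is the square of the original multiplier. -/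
theorem tan_family_odd_period_doubling (p q : ℕ) (hp : 0 < p) (hq : 0 < q)
    (hpq : Odd (p * q)) (lam : ℂ) (n : ℕ) (hn : 0 < n) (hnodd : Odd n)
    (z : ℂ) (hz : z ≠ 0)
    (hfix : (fun w : ℂ => lam * Complex.tan (w ^ q) ^ p)^[n] z = z)
    (hdiff : DifferentiableAt ℂ ((fun w : ℂ => lam * Complex.tan (w ^ q) ^ p)^[n]) z) :
    (fun w : ℂ => (-lam) * Complex.tan (w ^ q) ^ p)^[n] z = -z ∧
    -z ≠ z ∧
    (fun w : ℂ => (-lam) * Complex.tan (w ^ q) ^ p)^[2 * n] z = z ∧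
    deriv ((fun w : ℂ => (-lam) * Complex.tan (w ^ q) ^ p)^[2 * n]) z
      = (deriv ((fun w : ℂ => lam * Complex.tan (w ^ q) ^ p)^[n]) z) ^ 2 := by
  obtain ⟨hp_odd, hq_odd⟩ := Nat.odd_mul.1 hpq
  have hodd := odd_mul_tan_pow_pow hp_odd hq_odd lam
  simp only [neg_mul]
  rw [iterate_neg_of_odd hodd hnodd, iterate_neg_of_even hodd (even_two_mul n), mul_comm 2 n,
    iterate_mul]
  exact ⟨congrArg Neg.neg hfix, neg_ne_self.2 hz, iterate_fixed hfix 2,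
    (hdiff.hasDerivAt.iterate z hfix 2).deriv⟩
end

section
/- Let w : ℕ → ℂ be a sequence with sin(2·wₙ) ≠ 0 for all n. If wₙ / sin(2·wₙ) → 0 as n → ∞, then |Im(wₙ)| → ∞ as n → ∞ (i.e. Tendsto (fun n => |(w n).im|) atTop atTop). -/
open Complex Filter

theorem Complex.norm_cos_le_exp_abs_im (z : ℂ) : ‖Complex.cos z‖ ≤ Real.exp |z.im| := by
  have h₁ : ‖Complex.exp (z * I)‖ ≤ Real.exp |z.im| := by
    rw [Complex.norm_exp]
    simpa using neg_le_abs z.im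
  have h₂ : ‖Complex.exp (-z * I)‖ ≤ Real.exp |z.im| := by
    rw [Complex.norm_exp]
    simpa using le_abs_self z.im
  rw [Complex.cos, norm_div, Complex.norm_ofNat, div_le_iff₀ two_pos]
  linarith [norm_add_le (Complex.exp (z * I)) (Complex.exp (-z * I))]

theorem Complex.norm_sin_le_exp_abs_im_mul_norm (z : ℂ) :
    ‖Complex.sin z‖ ≤ Real.exp |z.im| * ‖z‖ := by
  have hconv : Convex ℝ {u : ℂ | |u.im| ≤ |z.im|} := by
    have : {u : ℂ | |u.im| ≤ |z.im|} = Complex.imLm ⁻¹' Set.Icc (-|z.im|) |z.im| := by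
      ext u
      simp [abs_le]
    rw [this]
    exact (convex_Icc _ _).linear_preimage _
  have key := hconv.norm_image_sub_le_of_norm_deriv_le (𝕜 := ℂ) (f := Complex.sin)
    (C := Real.exp |z.im|) (x := 0) (y := z)
    (fun u _ => Complex.differentiable_sin u)
    (fun u hu => by
      rw [Complex.deriv_sin]
      exact (Complex.norm_cos_le_exp_abs_im u).trans (Real.exp_le_exp.mpr hu))
    (by simp) (by simp)
  simpa using key

/-- If `wₙ / sin (2 wₙ) → 0` then `|Im wₙ| → ∞`. -/
theorem im_tendsto_atTop_of_multiplier_factor_tendsto_zero (w : ℕ → ℂ)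
    (hsin : ∀ n, Complex.sin (2 * w n) ≠ 0)
    (h : Tendsto (fun n => w n / Complex.sin (2 * w n)) atTop (nhds 0)) :
    Tendsto (fun n => |(w n).im|) atTop atTop := by
  refine tendsto_atTop.mpr fun M => ?_
  have hε : 0 < (2 * Real.exp (2 * M))⁻¹ := by positivity
  have hsmall := h.norm.eventually_lt_const (norm_zero.trans_lt hε)
  filter_upwards [hsmall] with n hn
  by_contra! hM
  have hpos : 0 < ‖Complex.sin (2 * w n)‖ := norm_pos_iff.mpr (hsin n)
  have hbound := Complex.norm_sin_le_exp_abs_im_mul_norm (2 * w n)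
  have him : |(2 * w n).im| = 2 * |(w n).im| := by simp [abs_mul]
  have hexp : Real.exp (2 * |(w n).im|) ≤ Real.exp (2 * M) := Real.exp_le_exp.mpr (by linarith)
  rw [him, norm_mul, Complex.norm_ofNat] at hbound
  rw [norm_div, div_lt_iff₀ hpos, inv_mul_eq_div, lt_div_iff₀ (by positivity)] at hn
  nlinarith [mul_le_mul_of_nonneg_right hexp (norm_nonneg (w n))]
end

section
/- Let p, q be positive integers with p·q ≥ 2 and r > 0 a real number, and let f_r(t) = r·tan(t^q)^p. Then there exists a unique z₀ ∈ (0, (π/2)^(1/q)) such that f_r(z₀) = z₀. -/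
open Real Set

theorem mul_tan_lt_mul_tan_of_lt {x y : ℝ} (hx : 0 < x) (hxy : x < y) (hy : y < π / 2) :
    y * tan x < x * tan y := by
  have hcx : 0 < cos x := cos_pos_of_mem_Ioo ⟨by linarith, by linarith⟩
  have hcy : 0 < cos y := cos_pos_of_mem_Ioo ⟨by linarith, by linarith⟩
  have hcyx : 0 < cos (y - x) := cos_pos_of_mem_Ioo ⟨by linarith, by linarith⟩
  have htx : 0 < tan x := tan_pos_of_pos_of_lt_pi_div_two hx (by linarith)
  have hlt : tan x < tan y := tan_lt_tan_of_nonneg_of_lt_pi_div_two hx.le hy hxy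
  have hsub : tan y - tan x = tan (y - x) * (1 + tan x * tan y) := by
    have h1 : tan (y - x) * cos (y - x) = sin (y - x) := tan_mul_cos hcyx.ne'
    have h2 : 1 + tan x * tan y = cos (y - x) / (cos x * cos y) := by
      rw [cos_sub, tan_eq_sin_div_cos, tan_eq_sin_div_cos]
      field_simp
    rw [h2, ← mul_div_assoc, h1, sin_sub, tan_eq_sin_div_cos, tan_eq_sin_div_cos]
    field_simp
  have hdiff : y - x < tan (y - x) := lt_tan (by linarith) (by linarith)
  have hsec : tan x ≤ x * (1 + tan x ^ 2) := by
    have hsin : sin x * cos x ≤ x := by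
      nlinarith [sin_le hx.le, cos_le_one x, sin_pos_of_pos_of_lt_pi hx (by linarith)]
    have h1 : x * (1 + tan x ^ 2) = x / cos x ^ 2 := by
      rw [tan_eq_sin_div_cos]
      field_simp
      linarith [sin_sq_add_cos_sq x]
    rw [h1, le_div_iff₀ (by positivity), tan_eq_sin_div_cos]
    field_simp
    linarith
  have hge : (y - x) * (1 + tan x ^ 2) < tan y - tan x := by
    rw [hsub]
    apply mul_lt_mul hdiff _ (by positivity) (by linarith)
    nlinarith
  nlinarith [mul_lt_mul_of_pos_left hge hx, mul_le_mul_of_nonneg_left hsec (sub_pos.2 hxy).le]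

theorem eq_of_mul_tan_pow_eq_self {n : ℕ} (hn : 1 ≤ n) {c x y : ℝ} (hc : 0 < c)
    (hx : x ∈ Ioo 0 (π / 2)) (hy : y ∈ Ioo 0 (π / 2))
    (hfx : c * tan x ^ n = x) (hfy : c * tan y ^ n = y) : x = y := by
  wlog hxy : x < y generalizing x y
  · rcases (not_lt.1 hxy).eq_or_lt with h | h
    · exact h.symm
    · exact (this hy hx hfy hfx h).symm
  exfalso
  obtain ⟨m, rfl⟩ := Nat.exists_eq_add_of_le' hn
  have htx : 0 < tan x := tan_pos_of_pos_of_lt_pi_div_two hx.1 hx.2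
  have hlt : tan x < tan y := tan_lt_tan_of_nonneg_of_lt_pi_div_two hx.1.le hy.2 hxy
  have hmain : y * tan x * tan x ^ m < x * tan y * tan y ^ m :=
    mul_lt_mul (mul_tan_lt_mul_tan_of_lt hx.1 hxy hy.2)
      (pow_le_pow_left₀ htx.le hlt.le m) (by positivity)
      (mul_nonneg hx.1.le (htx.trans hlt).le)
  have h := mul_lt_mul_of_pos_left hmain hc
  have h1 : c * (y * tan x * tan x ^ m) = y * x := by
    calc c * (y * tan x * tan x ^ m) = y * (c * tan x ^ (m + 1)) := by ring
      _ = y * x := by rw [hfx]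
  have h2 : c * (x * tan y * tan y ^ m) = x * y := by
    calc c * (x * tan y * tan y ^ m) = x * (c * tan y ^ (m + 1)) := by ring
      _ = x * y := by rw [hfy]
  linarith

theorem exists_mul_tan_pow_eq_self {n : ℕ} (hn : 2 ≤ n) {c : ℝ} (hc : 0 < c) :
    ∃ x ∈ Ioo 0 (π / 2), c * tan x ^ n = x := by
  obtain ⟨m, rfl⟩ := Nat.exists_eq_add_of_le' hn
  have hsmall : ∀ᶠ x in nhds (0 : ℝ), c * x ^ (m + 1) < cos x ^ (m + 2) := by
    apply ContinuousAt.eventually_lt (by fun_prop) (by fun_prop)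
    simp
  obtain ⟨a, ⟨hac, haπ⟩, ha⟩ := ((hsmall.and (gt_mem_nhds pi_div_two_pos)).filter_mono
    (nhdsWithin_le_nhds (s := Ioi 0))).and self_mem_nhdsWithin |>.exists
  have ha : 0 < a := ha
  have hneg : c * sin a ^ (m + 2) - a * cos a ^ (m + 2) < 0 := by
    have h1 : sin a ^ (m + 2) ≤ a ^ (m + 2) :=
      pow_le_pow_left₀ (sin_pos_of_pos_of_lt_pi ha (by linarith)).le (sin_le ha.le) _
    have h2 := mul_lt_mul_of_pos_left hac ha
    have h3 := mul_le_mul_of_nonneg_left h1 hc.le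
    have h4 : a * (c * a ^ (m + 1)) = c * a ^ (m + 2) := by ring
    linarith
  have hpos : 0 < c * sin (π / 2) ^ (m + 2) - π / 2 * cos (π / 2) ^ (m + 2) := by
    simpa using hc
  obtain ⟨x, ⟨hax, hxπ⟩, hx⟩ := intermediate_value_Ioo haπ.le
    (f := fun x ↦ c * sin x ^ (m + 2) - x * cos x ^ (m + 2)) (by fun_prop) ⟨hneg, hpos⟩
  have hcos : 0 < cos x := cos_pos_of_mem_Ioo ⟨by linarith, hxπ⟩
  refine ⟨x, ⟨ha.trans hax, hxπ⟩, ?_⟩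
  rw [tan_eq_sin_div_cos, div_pow, ← mul_div_assoc, div_eq_iff (by positivity)]
  exact sub_eq_zero.1 hx

/-- For `pq ≥ 2` and `r > 0`, the map `f_r(t) = r·tan(t^q)^p` has a unique fixed
point in `(0, (π/2)^(1/q))`. -/
theorem real_tan_family_unique_fixed_point (p q : ℕ) (hp : 0 < p) (hq : 0 < q)
    (hpq : 2 ≤ p * q) (r : ℝ) (hr : 0 < r) :
    ∃! z₀ : ℝ, z₀ ∈ Set.Ioo (0 : ℝ) ((π / 2) ^ (1 / (q : ℝ))) ∧
      r * Real.tan (z₀ ^ q) ^ p = z₀ := by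
  have hrq : 0 < r ^ q := by positivity
  have hpow (t : ℝ) : (r * tan t ^ p) ^ q = r ^ q * tan t ^ (p * q) := by
    rw [mul_pow, ← pow_mul]
  obtain ⟨x, hx, hfx⟩ := exists_mul_tan_pow_eq_self hpq hrq
  have hroot : (x ^ (1 / (q : ℝ))) ^ q = x := by
    rw [one_div, rpow_inv_natCast_pow hx.1.le hq.ne']
  have hzpos : 0 < x ^ (1 / (q : ℝ)) := rpow_pos_of_pos hx.1 _
  refine ⟨x ^ (1 / (q : ℝ)), ⟨⟨hzpos, rpow_lt_rpow hx.1.le hx.2 (by positivity)⟩, ?_⟩, ?_⟩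
  · have htan : 0 < tan x := tan_pos_of_pos_of_lt_pi_div_two hx.1 hx.2
    rw [hroot]
    refine (pow_left_inj₀ (by positivity) hzpos.le hq.ne').1 ?_
    rw [hroot, hpow, hfx]
  · rintro w ⟨⟨hw0, hwb⟩, hfw⟩
    have hwq : w ^ q < π / 2 := by
      have h := pow_lt_pow_left₀ hwb hw0.le hq.ne'
      rwa [one_div, rpow_inv_natCast_pow pi_div_two_pos.le hq.ne'] at h
    refine (pow_left_inj₀ hw0.le hzpos.le hq.ne').1 ?_
    rw [hroot]
    refine eq_of_mul_tan_pow_eq_self (by omega) hrq ⟨by positivity, hwq⟩ hx ?_ hfx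
    rw [← hpow, hfw]
end

section
/- Let p, q be positive integers with p·q ≥ 2, r > 0 real, f_r(t) = r·tan(t^q)^p, and let z₀ ∈ (0, (π/2)^(1/q)) be the fixed point of f_r in that interval. Then for every t ∈ (0, z₀): 0 < f_r(t) < t, and the iterates converge to the superattracting fixed point 0: Tendsto (fun n => f_r^[n](t)) atTop (𝓝 0). -/
open Real Set Filter Function

theorem Real.convexOn_tan_Ico : ConvexOn ℝ (Set.Ico 0 (π / 2)) Real.tan := by
  have hcos : ∀ x ∈ Set.Ico 0 (π / 2), 0 < Real.cos x := fun x hx =>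
    Real.cos_pos_of_mem_Ioo ⟨by linarith [Real.pi_pos, hx.1], hx.2⟩
  refine MonotoneOn.convexOn_of_deriv (convex_Ico _ _) ?_ ?_ ?_
  · exact fun x hx => (Real.continuousAt_tan.2 (hcos x hx).ne').continuousWithinAt
  · rw [interior_Ico]
    exact fun x hx =>
      (Real.differentiableAt_tan.2 (hcos x ⟨hx.1.le, hx.2⟩).ne').differentiableWithinAt
  · rw [interior_Ico]
    intro x hx y hy hxy
    have hy' := hcos y ⟨hy.1.le, hy.2⟩
    have hle : Real.cos y ≤ Real.cos x :=
      Real.cos_le_cos_of_nonneg_of_le_pi hx.1.le (by linarith [hy.2, Real.pi_pos]) hxy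
    simp only [Real.deriv_tan]
    gcongr

theorem Real.tan_mul_le_mul_tan {c x : ℝ} (hc₀ : 0 ≤ c) (hc₁ : c ≤ 1) (hx₀ : 0 ≤ x)
    (hx : x < π / 2) : Real.tan (c * x) ≤ c * Real.tan x := by
  have h := Real.convexOn_tan_Ico.2 (x := 0) (y := x) ⟨le_rfl, by positivity⟩ ⟨hx₀, hx⟩
    (sub_nonneg.2 hc₁) hc₀ (by ring)
  simpa using h

/-- Below the fixed point `z₀` of `f_r(t) = r·tan(t^q)^p` in `(0, (π/2)^(1/q))`, one
has `0 < f_r(t) < t` and the iterates converge to the superattracting fixed point `0`. -/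
theorem real_tan_family_basin_of_zero (p q : ℕ) (hp : 0 < p) (hq : 0 < q)
    (hpq : 2 ≤ p * q) (r : ℝ) (hr : 0 < r) (z₀ : ℝ)
    (hz₀ : z₀ ∈ Set.Ioo (0 : ℝ) ((π / 2) ^ (1 / (q : ℝ))))
    (hfix : r * Real.tan (z₀ ^ q) ^ p = z₀) :
    ∀ t ∈ Set.Ioo (0 : ℝ) z₀,
      0 < r * Real.tan (t ^ q) ^ p ∧
      r * Real.tan (t ^ q) ^ p < t ∧
      Tendsto (fun n => (fun s : ℝ => r * Real.tan (s ^ q) ^ p)^[n] t) atTop (nhds 0) := by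
  obtain ⟨hz, hzlt⟩ := hz₀
  have hzq : z₀ ^ q < π / 2 := by
    calc z₀ ^ q < ((π / 2) ^ (1 / (q : ℝ))) ^ q := pow_lt_pow_left₀ hzlt hz.le hq.ne'
      _ = π / 2 := by
        rw [one_div]
        exact Real.rpow_inv_natCast_pow (by positivity) hq.ne'
  have hpos : ∀ s ∈ Set.Ioo (0 : ℝ) z₀, 0 < Real.tan (s ^ q) := fun s hs =>
    Real.tan_pos_of_pos_of_lt_pi_div_two (pow_pos hs.1 q)
      ((pow_lt_pow_left₀ hs.2 hs.1.le hq.ne').trans hzq)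
  have hle : ∀ s ∈ Set.Ioo (0 : ℝ) z₀, r * Real.tan (s ^ q) ^ p ≤ s / z₀ * s := by
    intro s hs
    have hc₀ : 0 ≤ s / z₀ := div_nonneg hs.1.le hz.le
    have hc₁ : s / z₀ ≤ 1 := (div_le_one hz).2 hs.2.le
    have htan : Real.tan (s ^ q) ≤ (s / z₀) ^ q * Real.tan (z₀ ^ q) := by
      have h := Real.tan_mul_le_mul_tan (pow_nonneg hc₀ q) (pow_le_one₀ hc₀ hc₁)
        (pow_pos hz q).le hzq
      rwa [← mul_pow, div_mul_cancel₀ s hz.ne'] at h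
    calc r * Real.tan (s ^ q) ^ p
        ≤ r * ((s / z₀) ^ q * Real.tan (z₀ ^ q)) ^ p := by
          have := (hpos s hs).le
          gcongr
      _ = (s / z₀) ^ (p * q) * (r * Real.tan (z₀ ^ q) ^ p) := by
          rw [mul_pow, ← pow_mul, mul_comm q p]
          ring
      _ = (s / z₀) ^ (p * q) * z₀ := by rw [hfix]
      _ ≤ (s / z₀) ^ 2 * z₀ := by
          gcongr ?_ * z₀
          exact pow_le_pow_of_le_one hc₀ hc₁ hpq
      _ = s / z₀ * s := by
          field_simp
  intro t ht
  have hc₀ : 0 ≤ t / z₀ := div_nonneg ht.1.le hz.le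
  have hc₁ : t / z₀ < 1 := (div_lt_one hz).2 ht.2
  refine ⟨mul_pos hr (pow_pos (hpos t ht) p),
    (hle t ht).trans_lt (mul_lt_of_lt_one_left ht.1 hc₁), ?_⟩
  have hiter : ∀ n : ℕ, 0 < (fun s : ℝ => r * Real.tan (s ^ q) ^ p)^[n] t ∧
      (fun s : ℝ => r * Real.tan (s ^ q) ^ p)^[n] t ≤ (t / z₀) ^ n * t := by
    intro n
    induction n with
    | zero => simpa using ht.1
    | succ n ih =>
      rw [Function.iterate_succ_apply']
      generalize (fun s : ℝ => r * Real.tan (s ^ q) ^ p)^[n] t = s at ih ⊢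
      have hst : s ≤ t := ih.2.trans (mul_le_of_le_one_left ht.1.le (pow_le_one₀ hc₀ hc₁.le))
      have hs : s ∈ Set.Ioo (0 : ℝ) z₀ := ⟨ih.1, hst.trans_lt ht.2⟩
      refine ⟨mul_pos hr (pow_pos (hpos s hs) p), (hle s hs).trans ?_⟩
      calc s / z₀ * s ≤ t / z₀ * ((t / z₀) ^ n * t) := by
            have := ih.1.le
            gcongr
            exact ih.2
        _ = (t / z₀) ^ (n + 1) * t := by ring
  refine squeeze_zero (fun n => (hiter n).1.le) (fun n => (hiter n).2) ?_
  simpa using (tendsto_pow_atTop_nhds_zero_of_lt_one hc₀ hc₁).mul_const t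
end

section
/- Let p, q be positive integers with p·q ≥ 2, r > 0 real, f_r(t) = r·tan(t^q)^p, and let z₀ ∈ (0, (π/2)^(1/q)) be the fixed point of f_r in that interval. Then for every t ∈ (z₀, (π/2)^(1/q)), the derivative satisfies deriv f_r t > 1. -/
open Real Set

theorem hasDerivAt_const_mul_tan_pow_pow (p q : ℕ) (r t : ℝ) (h : cos (t ^ q) ≠ 0) :
    HasDerivAt (fun s : ℝ => r * Real.tan (s ^ q) ^ p)
      (r * (p * Real.tan (t ^ q) ^ (p - 1) * (1 / cos (t ^ q) ^ 2 * (q * t ^ (q - 1))))) t :=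
  (((Real.hasDerivAt_tan h).comp t (hasDerivAt_pow q t)).pow p).const_mul r

theorem Real.tan_lt_mul_one_div_cos_sq {x : ℝ} (hx : 0 < x) (hx' : x < π / 2) :
    Real.tan x < x * (1 / cos x ^ 2) := by
  have hc : 0 < cos x := cos_pos_of_mem_Ioo ⟨by linarith, hx'⟩
  have h := Real.sin_lt (show 0 < 2 * x by linarith)
  rw [Real.sin_two_mul] at h
  rw [Real.tan_eq_sin_div_cos, mul_one_div, div_lt_div_iff₀ hc (by positivity)]
  nlinarith

theorem mul_lt_self_mul_deriv_const_mul_tan_pow_pow {p q : ℕ} (hp : 0 < p) (hq : 0 < q)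
    {r t : ℝ} (hr : 0 < r) (ht : 0 < t) (ht' : t ^ q < π / 2) :
    (p * q : ℝ) * (r * Real.tan (t ^ q) ^ p) <
      t * deriv (fun s : ℝ => r * Real.tan (s ^ q) ^ p) t := by
  have hx : 0 < t ^ q := by positivity
  have hc : 0 < cos (t ^ q) := cos_pos_of_mem_Ioo ⟨by linarith, ht'⟩
  have hT := Real.tan_pos_of_pos_of_lt_pi_div_two hx ht'
  rw [(hasDerivAt_const_mul_tan_pow_pow p q r t hc.ne').deriv]
  calc (p * q : ℝ) * (r * Real.tan (t ^ q) ^ p)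
      = (p * q * r * Real.tan (t ^ q) ^ (p - 1)) * Real.tan (t ^ q) := by
        rw [← pow_sub_one_mul hp.ne' (Real.tan (t ^ q))]; ring
    _ < (p * q * r * Real.tan (t ^ q) ^ (p - 1)) * (t ^ q * (1 / cos (t ^ q) ^ 2)) := by
        have := Real.tan_lt_mul_one_div_cos_sq hx ht'
        gcongr
    _ = _ := by
        nth_rewrite 2 [← pow_sub_one_mul hq.ne' t]
        ring

/-- Above the fixed point `z₀` of `f_r(t) = r·tan(t^q)^p` in `(0, (π/2)^(1/q))`,
the derivative of `f_r` exceeds `1`. -/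
theorem real_tan_family_deriv_gt_one (p q : ℕ) (hp : 0 < p) (hq : 0 < q)
    (hpq : 2 ≤ p * q) (r : ℝ) (hr : 0 < r) (z₀ : ℝ)
    (hz₀ : z₀ ∈ Set.Ioo (0 : ℝ) ((π / 2) ^ (1 / (q : ℝ))))
    (hfix : r * Real.tan (z₀ ^ q) ^ p = z₀) :
    ∀ t ∈ Set.Ioo z₀ ((π / 2) ^ (1 / (q : ℝ))),
      1 < deriv (fun s : ℝ => r * Real.tan (s ^ q) ^ p) t := by
  rintro t ⟨hzt, ht⟩
  have hz := hz₀.1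
  have ht0 : 0 < t := hz.trans hzt
  have hpq' : (2 : ℝ) ≤ p * q := by exact_mod_cast hpq
  have htq : t ^ q < π / 2 := by
    calc t ^ q < ((π / 2) ^ (1 / (q : ℝ))) ^ q := pow_lt_pow_left₀ ht ht0.le hq.ne'
      _ = π / 2 := by rw [one_div, Real.rpow_inv_natCast_pow (by positivity) hq.ne']
  set f : ℝ → ℝ := fun s => r * Real.tan (s ^ q) ^ p
  have hsq : ∀ s ∈ Icc z₀ t, 0 < s ∧ s ^ q < π / 2 := fun s hs =>
    ⟨hz.trans_le hs.1, (pow_le_pow_left₀ (hz.le.trans hs.1) hs.2 q).trans_lt htq⟩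
  have hpos : ∀ s ∈ Icc z₀ t, 0 < f s := fun s hs => by
    have := Real.tan_pos_of_pos_of_lt_pi_div_two (pow_pos (hsq s hs).1 q) (hsq s hs).2
    positivity
  have hkey : ∀ s ∈ Icc z₀ t, 2 * f s < s * deriv f s := fun s hs =>
    (mul_le_mul_of_nonneg_right hpq' (hpos s hs).le).trans_lt
      (mul_lt_self_mul_deriv_const_mul_tan_pow_pow hp hq hr (hsq s hs).1 (hsq s hs).2)
  have hdiff : ∀ s ∈ Icc z₀ t, DifferentiableAt ℝ f s := fun s hs => by
    have hx := pow_pos (hsq s hs).1 q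
    exact (hasDerivAt_const_mul_tan_pow_pow p q r s
      (cos_pos_of_mem_Ioo ⟨by linarith [Real.pi_pos], (hsq s hs).2⟩).ne').differentiableAt
  have hdiv : ∀ s ∈ Icc z₀ t, HasDerivAt (fun s => f s / s)
      ((deriv f s * s - f s * 1) / s ^ 2) s := fun s hs =>
    (hdiff s hs).hasDerivAt.div (hasDerivAt_id s) (hsq s hs).1.ne'
  have hmono : MonotoneOn (fun s => f s / s) (Icc z₀ t) := by
    refine monotoneOn_of_deriv_nonneg (convex_Icc _ _)
      (fun s hs => (hdiv s hs).continuousAt.continuousWithinAt)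
      (fun s hs => (hdiv s (interior_subset hs)).differentiableAt.differentiableWithinAt)
      fun s hs => ?_
    have hs := interior_subset hs
    rw [(hdiv s hs).deriv]
    have := hkey s hs
    have := hpos s hs
    exact div_nonneg (by linarith) (sq_nonneg s)
  have hle : t ≤ f t := by
    have h := hmono (left_mem_Icc.2 hzt.le) (right_mem_Icc.2 hzt.le) hzt.le
    have hfz : f z₀ = z₀ := hfix
    simp only [hfz, div_self hz.ne'] at h
    exact (one_le_div ht0).1 h
  have h := hkey t (right_mem_Icc.2 hzt.le)
  exact lt_of_mul_lt_mul_left (by linarith) ht0.le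
end

section
/- Let p, q be positive integers and λ ∈ ℂ. Then f_λ(z) = λ·tan(z^q)^p tends to the asymptotic value i^p·λ as Im(z^q) → +∞; formally, Tendsto (fun z => λ·tan(z^q)^p) (comap (fun z => (z^q).im) atTop) (𝓝 (i^p·λ)), where i is the imaginary unit. -/
open Complex Filter

/-- The tangent as a Möbius transformation of `exp (2 * w * I)`; at the poles of `tan` both sides
take the value `0`. -/
theorem Complex.tan_eq_I_mul_one_sub_exp_div (w : ℂ) :
    Complex.tan w = I * (1 - exp (2 * w * I)) / (1 + exp (2 * w * I)) := by
  have h : exp (2 * w * I) = exp (w * I) * exp (w * I) := by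
    rw [← Complex.exp_add]
    ring_nf
  have hinv : exp (-w * I) * exp (w * I) = 1 := by
    rw [← Complex.exp_add]
    simp
  rw [Complex.tan, Complex.sin, Complex.cos, h, ← hinv, div_div_div_cancel_right₀ two_ne_zero,
    ← mul_div_mul_right _ _ (Complex.exp_ne_zero (w * I))]
  ring_nf

/-- The upper asymptotic value of the tangent is `i`. -/
theorem Complex.tendsto_tan_comap_im_atTop :
    Tendsto Complex.tan (comap im atTop) (nhds I) := by
  have hexp : Tendsto (fun w : ℂ => exp (2 * w * I)) (comap im atTop) (nhds 0) := by
    rw [Complex.tendsto_exp_nhds_zero_iff]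
    simpa using (tendsto_comap (f := im) (x := atTop)).const_mul_atTop (two_pos (α := ℝ))
  have h := ((hexp.const_sub 1).const_mul I).div (hexp.const_add 1) (by simp)
  simp only [sub_zero, add_zero, mul_one, div_one] at h
  exact h.congr fun w => (Complex.tan_eq_I_mul_one_sub_exp_div w).symm

/-- `f_λ(z) = λ·tan(z^q)^p` tends to the asymptotic value `i^p·λ` as `Im (z^q) → +∞`. -/
theorem tan_family_asymptotic_value (p q : ℕ) (hp : 0 < p) (hq : 0 < q) (lam : ℂ) :
    Tendsto (fun z : ℂ => lam * Complex.tan (z ^ q) ^ p)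
      (comap (fun z : ℂ => (z ^ q).im) atTop) (nhds (Complex.I ^ p * lam)) := by
  have hpow : Tendsto (fun z : ℂ => z ^ q) (comap (fun z : ℂ => (z ^ q).im) atTop)
      (comap im atTop) := tendsto_comap_iff.mpr tendsto_comap
  rw [mul_comm]
  exact ((Complex.tendsto_tan_comap_im_atTop.comp hpow).pow p).const_mul lam
end

section
/- Let p, q be positive odd integers and λ ∈ ℂ, λ ≠ 0, and suppose λ^q is purely imaginary (i.e. there exists c ∈ ℝ with λ^q = i·(c : ℂ)). Then f_λ interchanges the two perpendicular lines ℝ·λ and ℝ·(i·λ): for every t ∈ ℝ there exists s ∈ ℝ with f_λ(t·λ) = s·(i·λ), and for every t ∈ ℝ there exists s ∈ ℝ with f_λ(t·(i·λ)) = s·λ. Consequently any periodic orbit of f_λ contained in these two lines and meeting both has even period. -/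
open Complex Function Set

theorem Complex.I_pow_of_odd {n : ℕ} (hn : Odd n) : ∃ e : ℝ, I ^ n = (e : ℂ) * I := by
  obtain ⟨k, rfl⟩ := hn
  exact ⟨(-1) ^ k, by rw [pow_succ, pow_mul, I_sq]; push_cast; rfl⟩

/-- If `f` interchanges `A` and `B`, then its odd iterates map `A` into `B`. -/
theorem Set.MapsTo.iterate_of_odd {α : Type*} {f : α → α} {A B : Set α}
    (hAB : MapsTo f A B) (hBA : MapsTo f B A) {n : ℕ} (hn : Odd n) :
    MapsTo f^[n] A B := by
  obtain ⟨k, rfl⟩ := hn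
  have h : MapsTo f^[2 * k] A A := by
    rw [iterate_mul]
    exact (show MapsTo f^[2] A A from hBA.comp hAB).iterate k
  rw [← Nat.succ_eq_add_one, iterate_succ']
  exact hAB.comp h

/-- For `p, q` odd and `λ^q` purely imaginary, `f_λ(z) = λ·tan(z^q)^p` interchanges the
perpendicular lines `ℝ·λ` and `ℝ·(i·λ)`; consequently any periodic orbit contained in
these two lines and meeting both (away from their intersection) has even period. -/
theorem tan_family_interchanges_lines (p q : ℕ) (hp : Odd p) (hq : Odd q)
    (lam : ℂ) (hlam : lam ≠ 0) (himag : ∃ c : ℝ, lam ^ q = Complex.I * (c : ℂ)) :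
    (∀ t : ℝ, ∃ s : ℝ,
      lam * Complex.tan (((t : ℂ) * lam) ^ q) ^ p = (s : ℂ) * (Complex.I * lam)) ∧
    (∀ t : ℝ, ∃ s : ℝ,
      lam * Complex.tan (((t : ℂ) * (Complex.I * lam)) ^ q) ^ p = (s : ℂ) * lam) ∧
    (∀ (z : ℂ) (n : ℕ), 0 < n →
      (fun w : ℂ => lam * Complex.tan (w ^ q) ^ p)^[n] z = z →
      (∀ m : ℕ, 0 < m → m < n →
        (fun w : ℂ => lam * Complex.tan (w ^ q) ^ p)^[m] z ≠ z) →
      (∀ m : ℕ, (fun w : ℂ => lam * Complex.tan (w ^ q) ^ p)^[m] z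
          ∈ {w : ℂ | ∃ s : ℝ, w = (s : ℂ) * lam}
            ∪ {w : ℂ | ∃ s : ℝ, w = (s : ℂ) * (Complex.I * lam)}) →
      (∃ m : ℕ, (fun w : ℂ => lam * Complex.tan (w ^ q) ^ p)^[m] z
          ∈ {w : ℂ | ∃ s : ℝ, w = (s : ℂ) * lam} \
            {w : ℂ | ∃ s : ℝ, w = (s : ℂ) * (Complex.I * lam)}) →
      (∃ m : ℕ, (fun w : ℂ => lam * Complex.tan (w ^ q) ^ p)^[m] z
          ∈ {w : ℂ | ∃ s : ℝ, w = (s : ℂ) * (Complex.I * lam)} \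
            {w : ℂ | ∃ s : ℝ, w = (s : ℂ) * lam}) →
      Even n) := by
  obtain ⟨c, hc⟩ := himag
  obtain ⟨a, ha⟩ := I_pow_of_odd hp
  obtain ⟨b, hb⟩ := I_pow_of_odd hq
  have hAB : ∀ t : ℝ, ∃ s : ℝ,
      lam * Complex.tan (((t : ℂ) * lam) ^ q) ^ p = (s : ℂ) * (Complex.I * lam) := by
    intro t
    refine ⟨Real.tanh (t ^ q * c) ^ p * a, ?_⟩
    have h : ((t : ℂ) * lam) ^ q = ((t ^ q * c : ℝ) : ℂ) * I := by
      rw [mul_pow, hc]; push_cast; ring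
    rw [h, tan_mul_I, mul_pow, ha, ← ofReal_tanh]
    push_cast
    ring
  have hBA : ∀ t : ℝ, ∃ s : ℝ,
      lam * Complex.tan (((t : ℂ) * (Complex.I * lam)) ^ q) ^ p = (s : ℂ) * lam := by
    intro t
    refine ⟨Real.tan (-(t ^ q * b * c)) ^ p, ?_⟩
    have h : ((t : ℂ) * (I * lam)) ^ q = ((-(t ^ q * b * c) : ℝ) : ℂ) := by
      rw [mul_pow, mul_pow, hc, hb]
      push_cast
      linear_combination (t : ℂ) ^ q * b * c * I_mul_I
    rw [h, ← ofReal_tan, ← ofReal_pow, mul_comm]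
  refine ⟨hAB, hBA, ?_⟩
  rintro z n - hz - - ⟨m, hmA, hmB⟩ -
  by_contra hn
  refine hmB ?_
  have hper : IsPeriodicPt (fun w : ℂ => lam * Complex.tan (w ^ q) ^ p) n
      ((fun w : ℂ => lam * Complex.tan (w ^ q) ^ p)^[m] z) :=
    IsPeriodicPt.apply_iterate hz m
  rw [← hper.eq]
  refine MapsTo.iterate_of_odd ?_ ?_ (Nat.not_even_iff_odd.mp hn) hmA
  · rintro _ ⟨t, rfl⟩
    exact hAB t
  · rintro _ ⟨t, rfl⟩
    exact hBA t
end
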